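/- For every rho >= max{rho_{p}, rho_{Delta p} - 1}, the first derivative Delta f^rho_{p} is an admissible function. -/

import Mathlib

open scoped Classical

noncomputable section

/-! ## Binomial expansions and the Macaulay operations `(a_t)^+_+` and `(a_t)^-_-` -/

/-- The largest `k` such that `C(k,t) ≤ a` (top coefficient of the greedy binomial
expansion of `a` in base `t`). -/
def expTop (a t : ℕ) : ℕ := Nat.findGreatest (fun k => Nat.choose k t ≤ a) (a + t + 1)

/-- `(a_t)^+_+` : if `a = C(k(t),t) + ... + C(k(j),j)` is the binomial expansion of `a`
in base `t`, then `plusPlus a t = C(k(t)+1,t+1) + ... + C(k(j)+1,j+1)`; it sends `0` to `0`. -/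
def plusPlus : ℕ → ℕ → ℕ
  | _, 0 => 0
  | a, t + 1 =>
    if a = 0 then 0
    else Nat.choose (expTop a (t + 1) + 1) (t + 2) +
      plusPlus (a - Nat.choose (expTop a (t + 1)) (t + 1)) t

/-- `(a_t)^-_-` : if `a = C(k(t),t) + ... + C(k(j),j)` is the binomial expansion of `a`
in base `t`, then `minusMinus a t = C(k(t)-1,t-1) + ... + C(k(j)-1,j-1)`; it sends `0` to `0`. -/
def minusMinus : ℕ → ℕ → ℕ
  | _, 0 => 0
  | a, t + 1 =>
    if a = 0 then 0
    else Nat.choose (expTop a (t + 1) - 1) t +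
      minusMinus (a - Nat.choose (expTop a (t + 1)) (t + 1)) t

/-! ## Numerical functions -/

/-- A numerical function (modelled with values in `ℤ`) is *admissible* (an O-sequence) if it is
nonnegative, `H 0 = 1` and `H (t+1) ≤ (H(t)_t)^+_+` for every `t ≥ 1`. -/
def OSeq (H : ℕ → ℤ) : Prop :=
  (∀ t, 0 ≤ H t) ∧ H 0 = 1 ∧ ∀ t, 1 ≤ t → H (t + 1) ≤ (plusPlus (H t).toNat t : ℤ)

/-- First derivative of a numerical function: `Δf(0) = 1`, `Δf(t) = f(t) - f(t-1)`. -/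
def nderiv (f : ℕ → ℤ) : ℕ → ℤ
  | 0 => 1
  | t + 1 => f (t + 1) - f t

/-- Integral of a numerical function: `Σg(0) = 1`, `Σg(t) = Σg(t-1) + g(t)`. -/
def ninteg (g : ℕ → ℤ) : ℕ → ℤ
  | 0 => 1
  | t + 1 => ninteg g t + g (t + 1)

/-! ## Admissible Hilbert polynomials in Gotzmann form -/

/-- The integer-valued binomial coefficient `C(a,k)` for `a : ℤ`, agreeing with the
polynomial binomial coefficient `a(a-1)⋯(a-k+1)/k!`. -/
def zchoose (a : ℤ) (k : ℕ) : ℤ :=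
  if 0 ≤ a then (a.toNat.choose k : ℤ)
  else (-1) ^ k * (((k : ℤ) - 1 - a).toNat.choose k : ℤ)

/-- An admissible Hilbert polynomial, recorded through its Gotzmann form
`p(z) = C(z+k₁,k₁) + C(z+k₂-1,k₂) + ... + C(z+k_r-(r-1),k_r)` with `k₁ ≥ k₂ ≥ ... ≥ k_r ≥ 0`. -/
structure GotzmannPoly where
  ks : List ℕ
  sorted : ks.Pairwise (· ≥ ·)

namespace GotzmannPoly

/-- The Gotzmann number `r` of `p`. -/
def r (p : GotzmannPoly) : ℕ := p.ks.length

/-- The degree of `p`, namely `k₁`. -/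
def degree (p : GotzmannPoly) : ℕ := p.ks.headD 0

/-- Evaluation of `p` at an integer. -/
def eval (p : GotzmannPoly) (z : ℤ) : ℤ :=
  ∑ i ∈ Finset.range p.r, zchoose (z + (p.ks.getD i 0 : ℤ) - i) (p.ks.getD i 0)

/-- The first difference `Δp(z) = p(z) - p(z-1)`, in Gotzmann form. -/
def delta (p : GotzmannPoly) : GotzmannPoly where
  ks := (p.ks.filter fun k => 1 ≤ k).map fun k => k - 1
  sorted := by
    refine List.Pairwise.map _ (fun {a b} h => Nat.sub_le_sub_right h 1) ?_
    exact p.sorted.filter _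

/-- Iterated first difference `Δ^i p`. -/
def deltaIter (p : GotzmannPoly) (i : ℕ) : GotzmannPoly := delta^[i] p

/-- The polynomial `p(z) + c`, in Gotzmann form. -/
def addConst (p : GotzmannPoly) (c : ℕ) : GotzmannPoly where
  ks := p.ks ++ List.replicate c 0
  sorted := by
    rw [List.pairwise_append]
    refine ⟨p.sorted, ?_, ?_⟩
    · exact List.pairwise_replicate.2 (Or.inr le_rfl)
    · intro a _ b hb
      rw [List.eq_of_mem_replicate hb]
      exact Nat.zero_le a

end GotzmannPoly

/-- The set `Π_p = {1 ≤ t ≤ r : (p(t+h)_{t+h})^+_+ ≥ p(t+h+1) ≥ 1 for all h ≥ 0}`. -/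
def PiSet (p : GotzmannPoly) : Set ℕ :=
  {t | 1 ≤ t ∧ t ≤ p.r ∧ ∀ h : ℕ,
      p.eval ((t : ℤ) + (h : ℤ) + 1) ≤ (plusPlus (p.eval ((t : ℤ) + (h : ℤ))).toNat (t + h) : ℤ) ∧
      1 ≤ p.eval ((t : ℤ) + (h : ℤ) + 1)}

/-- `ρ_p`: `0` if `min Π_p = 1` and `p(0) = 1`, and `min Π_p` otherwise. -/
def rhoP (p : GotzmannPoly) : ℕ :=
  if sInf (PiSet p) = 1 ∧ p.eval 0 = 1 then 0 else sInf (PiSet p)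

/-- The minimal function `f^ρ_p` : `f(t) = p(t)` for `t ≥ ρ` and
`f(t) = ((f(t+1))_{t+1})^-_-` for `t < ρ`. -/
def fmin (p : GotzmannPoly) (ρ : ℕ) (t : ℕ) : ℤ :=
  if h : ρ ≤ t then p.eval (t : ℤ)
  else (minusMinus (fmin p ρ (t + 1)).toNat (t + 1) : ℤ)
termination_by ρ - t
decreasing_by omega

/-- The function `g^ρ_p` : `g(t) = p(t)` for `t ≥ ρ`, `g(ρ-1) = p(ρ-1) + 1` and
`g(t) = ((g(t+1))_{t+1})^-_-` for `t < ρ-1`. -/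
def gmin (p : GotzmannPoly) (ρ : ℕ) (t : ℕ) : ℤ :=
  if h : ρ ≤ t then p.eval (t : ℤ)
  else if t = ρ - 1 then p.eval (t : ℤ) + 1
  else (minusMinus (gmin p ρ (t + 1)).toNat (t + 1) : ℤ)
termination_by ρ - t
decreasing_by omega

/-- `H` has regularity `ρ` (with respect to the Hilbert polynomial `p`): `ρ` is the least
integer such that `H(t) = p(t)` for all `t ≥ ρ`. -/
def IsRegOf (p : GotzmannPoly) (H : ℕ → ℤ) (ρ : ℕ) : Prop :=
  (∀ t : ℕ, ρ ≤ t → H t = p.eval (t : ℤ)) ∧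
  ∀ ρ' : ℕ, (∀ t : ℕ, ρ' ≤ t → H t = p.eval (t : ℤ)) → ρ ≤ ρ'

/-- `H` has Hilbert polynomial `p`, i.e. eventually agrees with `p`. -/
def HasHP (p : GotzmannPoly) (H : ℕ → ℤ) : Prop :=
  ∃ N : ℕ, ∀ t : ℕ, N ≤ t → H t = p.eval (t : ℤ)

/-- `F(p,ρ)`: the set of Hilbert functions of closed projective subschemes (i.e. numerical
functions which are admissible together with their first derivative) with Hilbert
polynomial `p` and regularity `ρ`. -/
def Fset (p : GotzmannPoly) (ρ : ℕ) : Set (ℕ → ℤ) :=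
  {H | OSeq H ∧ OSeq (nderiv H) ∧ IsRegOf p H ρ}

/-- `ρ̄_p`: the minimal `ρ` such that `F(p,ρ)` is non-empty. -/
def rhobar (p : GotzmannPoly) : ℕ := sInf {ρ | (Fset p ρ).Nonempty}

/-! ## Monomial ideals in `K[x₀,…,xₙ]` (combinatorial model) -/

/-- Monomials of `K[x₀,…,xₙ]`, as exponent vectors. -/
abbrev Mon (n : ℕ) := Fin (n + 1) → ℕ

/-- Degree of a monomial. -/
def mdeg {n : ℕ} (m : Mon n) : ℕ := ∑ i, m i

/-- `T_t`, the set of terms of degree `t`. -/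
def Tset (n t : ℕ) : Set (Mon n) := {m | mdeg m = t}

/-- A set of monomials closed under multiplication by arbitrary monomials (a monomial ideal). -/
def MonIdeal {n : ℕ} (J : Set (Mon n)) : Prop :=
  ∀ m ∈ J, ∀ m' : Mon n, m + m' ∈ J

/-- The elementary Borel move sending `x^m` to `x_i · x^m / x_j`. -/
def borelStep {n : ℕ} (m : Mon n) (j i : Fin (n + 1)) : Mon n :=
  fun l => if l = j then m l - 1 else if l = i then m l + 1 else m l

/-- One elementary Borel move `x_j ↦ x_i` with `j < i`. -/
def borelMove {n : ℕ} (a b : Mon n) : Prop :=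
  ∃ j i : Fin (n + 1), j < i ∧ 1 ≤ a j ∧ b = borelStep a j i

/-- The Borel (partial) order `≤_B` on monomials. -/
def borelLE {n : ℕ} : Mon n → Mon n → Prop := Relation.ReflTransGen borelMove

/-- A strongly stable (Borel) monomial ideal. -/
def StronglyStable {n : ℕ} (J : Set (Mon n)) : Prop :=
  MonIdeal J ∧ ∀ m ∈ J, ∀ j i : Fin (n + 1), j < i → 1 ≤ m j → borelStep m j i ∈ J

/-- A Borel set in `T_t`: a set of degree-`t` monomials closed upwards under `≤_B`. -/
def IsBorelSet {n : ℕ} (t : ℕ) (B : Set (Mon n)) : Prop :=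
  B ⊆ Tset n t ∧ ∀ a ∈ B, ∀ b : Mon n, borelLE a b → b ∈ B

/-- Saturation of a monomial ideal:
`J^sat = {m : for every i there is k with x_i^k · m ∈ J}`. -/
def monSat {n : ℕ} (J : Set (Mon n)) : Set (Mon n) :=
  {m | ∀ i : Fin (n + 1), ∃ k : ℕ, (fun l => if l = i then m l + k else m l) ∈ J}

/-- The monomial ideal generated by a set of monomials. -/
def genIdeal {n : ℕ} (B : Set (Mon n)) : Set (Mon n) :=
  {m | ∃ b ∈ B, ∃ c : Mon n, m = b + c}

/-- The Hilbert function of `S/J` for a monomial ideal `J`: the number of degree-`t`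
monomials outside `J`. -/
def hilb {n : ℕ} (J : Set (Mon n)) (t : ℕ) : ℕ :=
  Set.ncard {m : Mon n | mdeg m = t ∧ m ∉ J}

/-- `m / x_i` as an exponent vector. -/
def shrinkAt {n : ℕ} (m : Mon n) (i : Fin (n + 1)) : Mon n :=
  fun l => if l = i then m l - 1 else m l

/-- `m` is a minimal (monomial) generator of the monomial ideal `J`. -/
def IsMinGen {n : ℕ} (J : Set (Mon n)) (m : Mon n) : Prop :=
  m ∈ J ∧ ∀ i : Fin (n + 1), 1 ≤ m i → shrinkAt m i ∉ J

/-- The Castelnuovo–Mumford regularity of a strongly stable ideal: the maximal degree of a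
minimal monomial generator. -/
def monReg {n : ℕ} (J : Set (Mon n)) : ℕ :=
  sSup {d | ∃ m : Mon n, IsMinGen J m ∧ mdeg m = d}

/-- `m_u`: the minimal Castelnuovo–Mumford regularity of a closed projective subscheme with
Hilbert function `u`, i.e. the minimum of `reg J` over all `n` and all saturated strongly
stable ideals `J ⊆ K[x₀,…,xₙ]` with `H_{S/J} = u`. -/
def mReg (u : ℕ → ℤ) : ℕ :=
  sInf {r | ∃ (n : ℕ) (J : Set (Mon n)), StronglyStable J ∧ monSat J = J ∧
      (∀ t : ℕ, (hilb J t : ℤ) = u t) ∧ monReg J = r}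

/-- `M(p,ρ) = {m_u : u ∈ F(p,ρ)}`. -/
def Mset (p : GotzmannPoly) (ρ : ℕ) : Set ℕ := {r | ∃ u ∈ Fset p ρ, mReg u = r}

/-- `m^ρ_p = min M(p,ρ)`. -/
def mRho (p : GotzmannPoly) (ρ : ℕ) : ℕ := sInf (Mset p ρ)

/-- `m_p`: the minimal Castelnuovo–Mumford regularity of schemes with Hilbert polynomial `p`. -/
def mP (p : GotzmannPoly) : ℕ := sInf {r | ∃ ρ : ℕ, ∃ u ∈ Fset p ρ, mReg u = r}

/-! ## Lex segments and growth-height-lexicographic Borel sets -/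

/-- `a` is smaller than `b` in the deglex order (for monomials of the same degree):
`a k < b k` where `k` is the largest index where they differ. -/
def deglexLT {n : ℕ} (a b : Mon n) : Prop :=
  ∃ k : Fin (n + 1), a k < b k ∧ ∀ l : Fin (n + 1), k < l → a l = b l

/-- A lex-segment of `T_t`: a set of degree-`t` monomials consisting of the highest terms
with respect to deglex. -/
def IsLexSeg {n : ℕ} (t : ℕ) (L : Set (Mon n)) : Prop :=
  L ⊆ Tset n t ∧ ∀ a ∈ L, ∀ b ∈ Tset n t, deglexLT a b → b ∈ L

/-- A lex-segment in `A ⊆ T_t`: the intersection of a lex-segment of `T_t` with `A`. -/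
def LexSegIn {n : ℕ} (t : ℕ) (A S : Set (Mon n)) : Prop :=
  ∃ L : Set (Mon n), IsLexSeg t L ∧ S = L ∩ A

/-- The growth class `B^{(i)} = {m ∈ B : min(m) = i}`. -/
def growthClass {n : ℕ} (B : Set (Mon n)) (i : Fin (n + 1)) : Set (Mon n) :=
  {m | m ∈ B ∧ 1 ≤ m i ∧ ∀ j : Fin (n + 1), j < i → m j = 0}

/-- The height class `B(i) = {m ∈ B : the exponent of x₀ in m is i}`. -/
def heightClass {n : ℕ} (B : Set (Mon n)) (i : ℕ) : Set (Mon n) :=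
  {m | m ∈ B ∧ m 0 = i}

/-- A Borel set `B ⊆ T_t` is growth-lexicographic if all its growth classes are lex-segments
in the corresponding growth classes of `T_t`. -/
def GrowthLex {n : ℕ} (t : ℕ) (B : Set (Mon n)) : Prop :=
  ∀ i : Fin (n + 1), LexSegIn t (growthClass (Tset n t) i) (growthClass B i)

/-- A Borel set `B ⊆ T_t` is growth-height-lexicographic if `B(0)` is growth-lexicographic
and `B(i)` is a lex-segment in `T_t(i)` for every `0 < i ≤ t`. -/
def GHLex {n : ℕ} (t : ℕ) (B : Set (Mon n)) : Prop :=
  GrowthLex t (heightClass B 0) ∧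
  ∀ i : ℕ, 0 < i → i ≤ t → LexSegIn t (heightClass (Tset n t) i) (heightClass B i)

end

/-! ## Binomial expansions -/

theorem lt_add_choose (a t : ℕ) : a < (a + (t + 1)).choose (t + 1) := by
  induction a with
  | zero => simp
  | succ a ih =>
    rw [show a + 1 + (t + 1) = (a + (t + 1)) + 1 by ring, Nat.choose_succ_succ]
    have : 0 < (a + (t + 1)).choose t := Nat.choose_pos (by omega)
    simp only [Nat.succ_eq_add_one]
    omega

theorem expTop_eq {a t k : ℕ} (ht : 1 ≤ t) (h1 : k.choose t ≤ a) (h2 : a < (k + 1).choose t) :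
    expTop a t = k := by
  obtain ⟨t, rfl⟩ : ∃ n, t = n + 1 := ⟨t - 1, by omega⟩
  have hb := lt_add_choose a t
  have hk : k ≤ a + (t + 1) + 1 := by
    by_contra hk
    have := Nat.choose_le_choose (t + 1) (show a + (t + 1) ≤ k by omega)
    omega
  rw [expTop, Nat.findGreatest_eq_iff]
  refine ⟨hk, fun _ => h1, fun n hn _ hle => ?_⟩
  have := Nat.choose_le_choose (t + 1) (show k + 1 ≤ n by omega)
  omega

/-- Leading term of the binomial expansion of a positive `a` in base `t + 1`. -/
theorem exists_leading_term {a : ℕ} (t : ℕ) (ha : 0 < a) :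
    ∃ k s : ℕ, t + 1 ≤ k ∧ s < k.choose t ∧ a = k.choose (t + 1) + s := by
  have hex : ∃ n : ℕ, a < n.choose (t + 1) := ⟨_, lt_add_choose a t⟩
  obtain ⟨k, hk, hmin⟩ : ∃ k : ℕ, a < (k + 1).choose (t + 1) ∧ k.choose (t + 1) ≤ a := by
    have h1 := Nat.find_spec hex
    have h0 : Nat.find hex ≠ 0 := by
      intro h
      rw [h] at h1
      simp at h1
    refine ⟨Nat.find hex - 1, ?_, ?_⟩
    · rwa [Nat.sub_add_cancel (by omega)]
    · exact not_lt.1 (Nat.find_min hex (by omega))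
  have hk' : t + 1 ≤ k := by
    by_contra h
    have := Nat.choose_le_choose (t + 1) (show k + 1 ≤ t + 1 by omega)
    rw [Nat.choose_self] at this
    omega
  refine ⟨k, a - k.choose (t + 1), hk', ?_, by omega⟩
  rw [Nat.choose_succ_succ] at hk
  simp only [Nat.succ_eq_add_one] at hk
  omega

theorem expTop_leading {k s t : ℕ} (hs : s < k.choose t) :
    expTop (k.choose (t + 1) + s) (t + 1) = k := by
  refine expTop_eq (by omega) (by omega) ?_
  rw [Nat.choose_succ_succ]
  simp only [Nat.succ_eq_add_one]
  omega

theorem plusPlus_zero (t : ℕ) : plusPlus 0 t = 0 := by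
  cases t <;> simp [plusPlus]

theorem minusMinus_zero (t : ℕ) : minusMinus 0 t = 0 := by
  cases t <;> simp [minusMinus]

theorem plusPlus_leading {k s t : ℕ} (hk : t + 1 ≤ k) (hs : s < k.choose t) :
    plusPlus (k.choose (t + 1) + s) (t + 1) = (k + 1).choose (t + 2) + plusPlus s t := by
  have hp : 0 < k.choose (t + 1) := Nat.choose_pos hk
  rw [plusPlus, if_neg (by omega), expTop_leading hs, Nat.add_sub_cancel_left]

theorem minusMinus_leading {k s t : ℕ} (hk : t + 1 ≤ k) (hs : s < k.choose t) :
    minusMinus (k.choose (t + 1) + s) (t + 1) = (k - 1).choose t + minusMinus s t := by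
  have hp : 0 < k.choose (t + 1) := Nat.choose_pos hk
  rw [minusMinus, if_neg (by omega), expTop_leading hs, Nat.add_sub_cancel_left]

theorem choose_pred_add {k t : ℕ} (hk : 1 ≤ k) :
    k.choose (t + 1) = (k - 1).choose t + (k - 1).choose (t + 1) := by
  obtain ⟨k, rfl⟩ : ∃ n, k = n + 1 := ⟨k - 1, by omega⟩
  exact Nat.choose_succ_succ k t

theorem minusMinus_le (a t : ℕ) : minusMinus a t ≤ a := by
  induction t generalizing a with
  | zero => simp [minusMinus]
  | succ t ih =>
    rcases Nat.eq_zero_or_pos a with rfl | ha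
    · simp [minusMinus]
    obtain ⟨k, s, hk, hs, rfl⟩ := exists_leading_term t ha
    rw [minusMinus_leading hk hs, choose_pred_add (show 1 ≤ k by omega)]
    have := ih s
    omega

theorem sub_minusMinus_lt {a k t : ℕ} (hk : t + 1 ≤ k) (ha : a < k.choose t) :
    a - minusMinus a t < (k - 1).choose t := by
  induction t generalizing a k with
  | zero => simp_all
  | succ t ih =>
    rcases Nat.eq_zero_or_pos a with rfl | hpos
    · simpa using Nat.choose_pos (show t + 1 ≤ k - 1 by omega)
    obtain ⟨l, s, hl, hs, rfl⟩ := exists_leading_term t hpos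
    have hlk : l ≤ k - 1 := by
      by_contra h
      have := Nat.choose_le_choose (t + 1) (show k ≤ l by omega)
      omega
    rw [minusMinus_leading hl hs]
    have h1 := ih hl hs
    have h2 := choose_pred_add (t := t) (show 1 ≤ l by omega)
    have h3 := Nat.choose_le_choose (t + 1) hlk
    have h4 := minusMinus_le s t
    omega

theorem minusMinus_le_choose {a k t : ℕ} (ha : a < k.choose (t + 1)) :
    minusMinus a (t + 1) ≤ (k - 1).choose t := by
  induction t generalizing a k with
  | zero =>
    rcases Nat.eq_zero_or_pos a with rfl | hpos
    · simp [minusMinus]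
    obtain ⟨l, s, hl, hs, rfl⟩ := exists_leading_term 0 hpos
    rw [minusMinus_leading hl hs]
    simp [minusMinus]
  | succ t ih =>
    rcases Nat.eq_zero_or_pos a with rfl | hpos
    · simp [minusMinus]
    obtain ⟨l, s, hl, hs, rfl⟩ := exists_leading_term (t + 1) hpos
    have hlk : l ≤ k - 1 := by
      by_contra h
      have := Nat.choose_le_choose (t + 1 + 1) (show k ≤ l by omega)
      omega
    rw [minusMinus_leading hl hs]
    have h1 := ih hs
    have h2 := choose_pred_add (t := t) (show 1 ≤ l by omega)
    have h3 := Nat.choose_le_choose (t + 1) hlk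
    omega

/-- Pascal's rule for `(a_t)^+_+`: the largest growth of `a - (a_t)^-_-` is the largest growth of
`a` minus `a`. -/
theorem plusPlus_eq_add {a t : ℕ} (h : t = 0 → a = 0) :
    plusPlus a t = a + plusPlus (a - minusMinus a t) t := by
  induction t generalizing a with
  | zero => simp [h rfl, plusPlus]
  | succ t ih =>
    rcases Nat.eq_zero_or_pos a with rfl | hpos
    · simp [plusPlus_zero]
    obtain ⟨k, s, hk, hs, rfl⟩ := exists_leading_term t hpos
    have hlt := sub_minusMinus_lt hk hs
    have hle := minusMinus_le s t
    have hs0 : t = 0 → s = 0 := by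
      rintro rfl
      simpa using hs
    have hsub : k.choose (t + 1) + s - minusMinus (k.choose (t + 1) + s) (t + 1) =
        (k - 1).choose (t + 1) + (s - minusMinus s t) := by
      have := choose_pred_add (t := t) (show 1 ≤ k by omega)
      rw [minusMinus_leading hk hs]
      omega
    rw [hsub, plusPlus_leading hk hs, ih hs0, Nat.choose_succ_succ]
    simp only [Nat.succ_eq_add_one, Nat.add_assoc, Nat.reduceAdd]
    rcases hk.lt_or_eq with hk' | rfl
    · rw [plusPlus_leading (show t + 1 ≤ k - 1 by omega) hlt, Nat.sub_add_cancel (by omega)]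
      omega
    · have h0 : s - minusMinus s t = 0 := by simpa using hlt
      simp [h0, plusPlus_zero]

theorem le_plusPlus_minusMinus (b t : ℕ) :
    b ≤ plusPlus (minusMinus b (t + 2)) (t + 1) := by
  induction t generalizing b with
  | zero =>
    rcases Nat.eq_zero_or_pos b with rfl | hpos
    · simp
    obtain ⟨k, s, hk, hs, rfl⟩ := exists_leading_term 1 hpos
    rw [minusMinus_leading hk hs]
    rcases Nat.eq_zero_or_pos s with rfl | hs'
    · rw [minusMinus_zero, plusPlus_leading (by omega) (by simp), Nat.sub_add_cancel (by omega)]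
      simp
    · have h1 : minusMinus s 1 = 1 := by simp [minusMinus, hs'.ne']
      have h2 : (k - 1).choose 1 + minusMinus s 1 = k.choose 1 + 0 := by
        rw [h1]
        simp
        omega
      rw [h2, plusPlus_leading (by omega) (by simp), Nat.choose_succ_succ]
      simp only [Nat.succ_eq_add_one] at *
      omega
  | succ t ih =>
    rcases Nat.eq_zero_or_pos b with rfl | hpos
    · simp
    obtain ⟨k, s, hk, hs, rfl⟩ := exists_leading_term (t + 2) hpos
    rw [minusMinus_leading hk hs]
    rcases (minusMinus_le_choose hs).lt_or_eq with hlt | heq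
    · rw [plusPlus_leading (by omega) hlt, Nat.sub_add_cancel (by omega)]
      have := ih s
      simp only [Nat.add_assoc, Nat.reduceAdd] at *
      omega
    · have h2 : (k - 1).choose (t + 2) + minusMinus s (t + 2) = k.choose (t + 2) + 0 := by
        rw [heq, choose_pred_add (show 1 ≤ k by omega)]
        exact add_comm _ _
      rw [h2, plusPlus_leading (by omega) (Nat.choose_pos (by omega)), Nat.choose_succ_succ]
      simp only [Nat.succ_eq_add_one, Nat.add_assoc, Nat.reduceAdd] at *
      omega

/-! ## Gotzmann forms -/

theorem zchoose_succ (a : ℤ) (k : ℕ) :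
    zchoose (a + 1) (k + 1) = zchoose a (k + 1) + zchoose a k := by
  unfold zchoose
  rcases lt_trichotomy a (-1) with h | rfl | h
  · obtain ⟨m, rfl⟩ : ∃ m : ℕ, a = -(m + 2) := ⟨(-a - 2).toNat, by omega⟩
    rw [if_neg (by omega), if_neg (by omega), if_neg (by omega)]
    rw [show (((k + 1 : ℕ) : ℤ) - 1 - (-((m : ℤ) + 2) + 1)).toNat = k + m + 1 by omega,
      show (((k + 1 : ℕ) : ℤ) - 1 - (-((m : ℤ) + 2))).toNat = (k + m + 1) + 1 by omega,
      show ((k : ℤ) - 1 - (-((m : ℤ) + 2))).toNat = k + m + 1 by omega,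
      Nat.choose_succ_succ (k + m + 1) k]
    push_cast
    ring
  · simp [pow_succ]
  · rw [if_pos (by omega), if_pos (by omega), if_pos (by omega),
      show (a + 1).toNat = a.toNat + 1 by omega, Nat.choose_succ_succ]
    push_cast
    ring

theorem zchoose_zero (a : ℤ) : zchoose a 0 = 1 := by
  simp [zchoose]

/-- Evaluation of a Gotzmann form given as a list of exponents. -/
def gotzmannSum : List ℕ → ℤ → ℤ
  | [], _ => 0
  | k :: ks, z => zchoose (z + k) k + gotzmannSum ks (z - 1)

theorem eval_eq_gotzmannSum (p : GotzmannPoly) (z : ℤ) : p.eval z = gotzmannSum p.ks z := by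
  have key (ks : List ℕ) (z : ℤ) : ∑ i ∈ Finset.range ks.length,
      zchoose (z + (ks.getD i 0 : ℤ) - i) (ks.getD i 0) = gotzmannSum ks z := by
    induction ks generalizing z with
    | nil => simp [gotzmannSum]
    | cons k ks ih =>
      rw [List.length_cons, Finset.sum_range_succ', gotzmannSum, ← ih, add_comm]
      congr 1
      · simp
      · refine Finset.sum_congr rfl fun i _ => ?_
        rw [List.getD_cons_succ]
        congr 1
        push_cast
        ring
  exact key p.ks z

theorem gotzmannSum_delta {ks : List ℕ} (h : ks.Pairwise (· ≥ ·)) (z : ℤ) :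
    gotzmannSum ((ks.filter fun k => 1 ≤ k).map fun k => k - 1) z =
      gotzmannSum ks z - gotzmannSum ks (z - 1) := by
  induction ks generalizing z with
  | nil => simp [gotzmannSum]
  | cons k ks ih =>
    rw [List.pairwise_cons] at h
    have ih' := ih h.2 (z - 1)
    rcases k with _ | k
    · have hf : (ks.filter fun k => 1 ≤ k) = [] := by
        rw [List.filter_eq_nil_iff]
        intro a ha
        have := h.1 a ha
        simp
        omega
      rw [hf] at ih'
      rw [List.filter_cons_of_neg (by simp), hf]
      simp only [List.map_nil, gotzmannSum, zchoose_zero] at ih' ⊢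
      linarith
    · rw [List.filter_cons_of_pos (by simp), List.map_cons]
      simp only [gotzmannSum, Nat.add_sub_cancel]
      have hz := zchoose_succ (z + k) k
      rw [ih']
      push_cast
      rw [← add_assoc, hz, show z - 1 + ((k : ℤ) + 1) = z + k by ring]
      ring

theorem eval_delta (p : GotzmannPoly) (z : ℤ) :
    p.delta.eval z = p.eval z - p.eval (z - 1) := by
  simp only [eval_eq_gotzmannSum]
  exact gotzmannSum_delta p.sorted z

/-- The value of a Gotzmann form at `t`, for `t` at least its length, as a binomial expansion in
base `t`. -/
def gotzmannExpansion : List ℕ → ℕ → ℕ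
  | [], _ => 0
  | k :: ks, t => (t + k).choose t + gotzmannExpansion ks (t - 1)

theorem gotzmannSum_eq_expansion {ks : List ℕ} {t : ℕ} (h : ks.length ≤ t) :
    gotzmannSum ks t = gotzmannExpansion ks t := by
  induction ks generalizing t with
  | nil => simp [gotzmannSum, gotzmannExpansion]
  | cons k ks ih =>
    rw [List.length_cons] at h
    rw [gotzmannSum, gotzmannExpansion, show (t : ℤ) - 1 = ((t - 1 : ℕ) : ℤ) by omega,
      ih (by omega), zchoose, if_pos (by omega), show ((t : ℤ) + k).toNat = t + k by omega,
      Nat.choose_symm_add]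
    push_cast
    rfl

theorem gotzmannExpansion_lt {ks : List ℕ} (hs : ks.Pairwise (· ≥ ·)) {t K : ℕ}
    (hK : ∀ k ∈ ks, k ≤ K) (ht : ks.length ≤ t) :
    gotzmannExpansion ks t < (t + K + 1).choose t := by
  induction ks generalizing t K with
  | nil => simpa [gotzmannExpansion] using Nat.choose_pos (show t ≤ t + K + 1 by omega)
  | cons k ks ih =>
    rw [List.pairwise_cons] at hs
    rw [List.length_cons] at ht
    obtain ⟨t, rfl⟩ : ∃ n, t = n + 1 := ⟨t - 1, by omega⟩
    have h1 := ih hs.2 (t := t) (K := k) hs.1 (by omega)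
    have h2 := Nat.choose_le_choose (t + 1)
      (show t + 1 + k + 1 ≤ t + 1 + K + 1 by have := hK k (by simp); omega)
    rw [Nat.choose_succ_succ (t + 1 + k), show t + 1 + k = t + k + 1 by ring] at h2
    rw [gotzmannExpansion, Nat.add_sub_cancel, show t + 1 + k = t + k + 1 by ring]
    simp only [Nat.succ_eq_add_one] at h2
    omega

theorem plusPlus_gotzmannExpansion {ks : List ℕ} (hs : ks.Pairwise (· ≥ ·)) {t : ℕ}
    (ht : ks.length ≤ t) :
    plusPlus (gotzmannExpansion ks t) t = gotzmannExpansion ks (t + 1) := by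
  induction ks generalizing t with
  | nil => simp [gotzmannExpansion, plusPlus_zero]
  | cons k ks ih =>
    rw [List.pairwise_cons] at hs
    rw [List.length_cons] at ht
    obtain ⟨t, rfl⟩ : ∃ n, t = n + 1 := ⟨t - 1, by omega⟩
    have h1 := gotzmannExpansion_lt hs.2 (t := t) (K := k) hs.1 (by omega)
    rw [gotzmannExpansion, gotzmannExpansion, Nat.add_sub_cancel, Nat.add_sub_cancel,
      plusPlus_leading (by omega) (by rwa [show t + 1 + k = t + k + 1 by ring]),
      ih hs.2 (by omega), show t + 1 + k + 1 = t + 1 + 1 + k by ring]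

theorem r_mem_PiSet {p : GotzmannPoly} (hp : 1 ≤ p.r) : p.r ∈ PiSet p := by
  have heval (t : ℕ) (ht : p.r ≤ t) : p.eval t = gotzmannExpansion p.ks t := by
    rw [eval_eq_gotzmannSum, gotzmannSum_eq_expansion ht]
  refine ⟨hp, le_rfl, fun h => ?_⟩
  have h1 : p.eval ((p.r : ℤ) + h) = gotzmannExpansion p.ks (p.r + h) := by
    rw [← heval _ (by omega)]
    push_cast
    rfl
  have h2 : p.eval ((p.r : ℤ) + h + 1) = gotzmannExpansion p.ks (p.r + h + 1) := by
    rw [← heval _ (by omega)]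
    push_cast
    rfl
  have ht : p.ks.length ≤ p.r + h := Nat.le_add_right _ h
  rw [h1, h2, Int.toNat_natCast, plusPlus_gotzmannExpansion p.sorted ht]
  refine ⟨le_rfl, ?_⟩
  have hpos : 0 < gotzmannExpansion p.ks (p.r + h + 1) := by
    obtain ⟨ks, hs⟩ := p
    rcases ks with _ | ⟨k, ks⟩
    · simp [GotzmannPoly.r] at hp
    · exact Nat.add_pos_left (Nat.choose_pos (Nat.le_add_right _ k)) _
  exact_mod_cast hpos

/-- Beyond `ρ_p`, the values of an admissible Hilbert polynomial satisfy Macaulay's bound. -/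
theorem eval_growth (p : GotzmannPoly) {t : ℕ} (ht : 1 ≤ t) (hρ : rhoP p ≤ t) :
    p.eval ((t : ℤ) + 1) ≤ (plusPlus (p.eval t).toNat t : ℤ) ∧ 0 ≤ p.eval t := by
  rcases Nat.eq_zero_or_pos p.r with h0 | hr
  · simp [GotzmannPoly.eval, h0]
  have hmem := Nat.sInf_mem ⟨_, r_mem_PiSet hr⟩
  have hle : sInf (PiSet p) ≤ t := by
    unfold rhoP at hρ
    split_ifs at hρ with h
    · omega
    · exact hρ
  have hg := hmem.2.2 (t - sInf (PiSet p))
  rw [show ((sInf (PiSet p) : ℕ) : ℤ) + ((t - sInf (PiSet p) : ℕ) : ℤ) = t by omega,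
    show sInf (PiSet p) + (t - sInf (PiSet p)) = t by omega] at hg
  refine ⟨hg.1, ?_⟩
  by_contra hneg
  rw [Int.toNat_of_nonpos (by omega), plusPlus_zero] at hg
  have := hg.1
  push_cast at this
  omega

theorem fmin_of_le (p : GotzmannPoly) {ρ t : ℕ} (h : ρ ≤ t) : fmin p ρ t = p.eval t := by
  rw [fmin, dif_pos h]

theorem fmin_of_lt (p : GotzmannPoly) {ρ t : ℕ} (h : t < ρ) :
    fmin p ρ t = (minusMinus (fmin p ρ (t + 1)).toNat (t + 1) : ℤ) := by
  rw [fmin, dif_neg (by omega)]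

/-- Lemma `lemma:first derivative` (iii).
For every `ρ ≥ max{ρ_p, ρ_{Δp} - 1}`, the first derivative `Δf^ρ_p` is admissible. -/
theorem statement6 (p : GotzmannPoly) (hr : 1 < p.r) (ρ : ℕ)
    (hρ : max (rhoP p) (rhoP p.delta - 1) ≤ ρ) :
    OSeq (nderiv (fmin p ρ)) := by
  obtain ⟨hρ₁, hρ₂⟩ := max_le_iff.1 hρ
  have hnonneg {t : ℕ} (ht : 1 ≤ t) (htρ : t ≤ ρ) : 0 ≤ fmin p ρ t := by
    rcases htρ.lt_or_eq with h | rfl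
    · rw [fmin_of_lt p h]
      positivity
    · rw [fmin_of_le p le_rfl]
      exact (eval_growth p ht hρ₁).2
  have hgrowth {t : ℕ} (ht : 1 ≤ t) (htρ : t ≤ ρ) :
      fmin p ρ (t + 1) ≤ (plusPlus (fmin p ρ t).toNat t : ℤ) := by
    rcases htρ.lt_or_eq with h | rfl
    · have hb := le_plusPlus_minusMinus (fmin p ρ (t + 1)).toNat (t - 1)
      rw [show t - 1 + 2 = t + 1 by omega, show t - 1 + 1 = t by omega] at hb
      rw [fmin_of_lt p h, Int.toNat_natCast]
      exact Int.toNat_le.1 hb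
    · rw [fmin_of_le p le_rfl, fmin_of_le p (Nat.le_succ _)]
      exact_mod_cast (eval_growth p ht hρ₁).1
  have hlow {t : ℕ} (ht : 1 ≤ t) (htρ : t ≤ ρ) : nderiv (fmin p ρ) t =
      ((fmin p ρ t).toNat - minusMinus (fmin p ρ t).toNat t : ℕ) := by
    obtain ⟨t, rfl⟩ : ∃ n, t = n + 1 := ⟨t - 1, by omega⟩
    rw [nderiv, fmin_of_lt p (show t < ρ by omega), Nat.cast_sub (minusMinus_le _ _),
      Int.toNat_of_nonneg (hnonneg ht htρ)]
  have hhigh {t : ℕ} (htρ : ρ < t) : nderiv (fmin p ρ) t = p.delta.eval t := by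
    obtain ⟨t, rfl⟩ : ∃ n, t = n + 1 := ⟨t - 1, by omega⟩
    rw [nderiv, fmin_of_le p (by omega), fmin_of_le p (show ρ ≤ t by omega), eval_delta]
    push_cast
    rw [add_sub_cancel_right]
  refine ⟨fun t => ?_, rfl, fun t ht => ?_⟩
  · rcases Nat.eq_zero_or_pos t with rfl | ht
    · exact zero_le_one
    rcases le_or_gt t ρ with h | h
    · rw [hlow ht h]
      positivity
    · rw [hhigh h]
      exact (eval_growth p.delta ht (by omega)).2
  · rcases le_or_gt t ρ with h | h
    · have hp := plusPlus_eq_add (a := (fmin p ρ t).toNat) (show t = 0 → _ by omega)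
      have hg := hgrowth ht h
      have hn := hnonneg ht h
      rw [hlow ht h, Int.toNat_natCast, nderiv]
      omega
    · rw [hhigh h, hhigh (show ρ < t + 1 by omega)]
      exact_mod_cast (eval_growth p.delta ht (by omega)).1
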